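/- Define $a_{im}=\sum_{j=i}^{N-1}q^{jm}(q^{|m|/2}\ep_{jm}-q^{-|m|/2}\ep_{j+1,m})+a_{Nm}$ for $1\le i\le N-1$ (so $a_{im}=\oh_{im}+a_{i+1,m}$ with $\oh_{jm}=q^{jm}(q^{|m|/2}\ep_{jm}-q^{-|m|/2}\ep_{j+1,m})$). Then $[a_{im},a_{in}]=0$ for each $i$ and all nonzero $m,n$, and $[a_{im},a_{jn}]=-\frac{q^m}{m}[m][mc]\delta_{m,-n}$ for $i>j$. -/

import Mathlib

section Tail

variable {L : Type*} [LieRing L] [LieAlgebra ℂ L] {N : ℕ} {α β : ℂ} {Z x y : L} {u v : ℕ → L}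

/-- An element `u k` pairing with a chain `v` as in type `A` sees only the next term of a tail. -/
lemma lie_tail_of_lt
    (huv : ∀ i j, 1 ≤ i → i < j → j < N → ⁅u i, v j⁆ = (if j = i + 1 then β else 0) • Z)
    (huy : ∀ i, 1 ≤ i → i < N → ⁅u i, y⁆ = (if i + 1 = N then β else 0) • Z)
    {k i : ℕ} (hk : 1 ≤ k) (hki : k < i) (hi : i ≤ N) :
    ⁅u k, (∑ j ∈ Finset.Ico i N, v j) + y⁆ = (if i = k + 1 then β else 0) • Z := by
  induction hi using Nat.decreasingInduction with
  | self => simp [huy k hk hki, eq_comm]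
  | of_succ i hi ih =>
    rw [Finset.sum_eq_sum_Ico_succ_bot hi, add_assoc, lie_add, huv k i hk hki hi, ih (by omega),
      if_neg (show ¬ i + 1 = k + 1 by omega), zero_smul, add_zero]

lemma tail_lie_of_lt
    (huv : ∀ i j, 1 ≤ j → j < i → i < N → ⁅u i, v j⁆ = (if i = j + 1 then α else 0) • Z)
    (hxv : ∀ j, 1 ≤ j → j < N → ⁅x, v j⁆ = (if j + 1 = N then α else 0) • Z)
    {k i : ℕ} (hk : 1 ≤ k) (hki : k < i) (hi : i ≤ N) :
    ⁅(∑ j ∈ Finset.Ico i N, u j) + x, v k⁆ = (if i = k + 1 then α else 0) • Z := by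
  rw [← lie_skew, lie_tail_of_lt (β := -α) (Z := Z) (N := N) ?_ ?_ hk hki hi]
  · split_ifs <;> simp
  · intro i j hi hij hj
    rw [← lie_skew, huv j i hi hij hj]
    split_ifs <;> simp
  · intro i hi hiN
    rw [← lie_skew, hxv i hi hiN]
    split_ifs <;> simp

lemma tail_lie_tail_self
    (hlt : ∀ i j, 1 ≤ i → i < j → j < N → ⁅u i, v j⁆ = (if j = i + 1 then β else 0) • Z)
    (hgt : ∀ i j, 1 ≤ j → j < i → i < N → ⁅u i, v j⁆ = (if i = j + 1 then α else 0) • Z)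
    (hself : ∀ i, 1 ≤ i → i < N → ⁅u i, v i⁆ = -(α + β) • Z)
    (huy : ∀ i, 1 ≤ i → i < N → ⁅u i, y⁆ = (if i + 1 = N then β else 0) • Z)
    (hxv : ∀ j, 1 ≤ j → j < N → ⁅x, v j⁆ = (if j + 1 = N then α else 0) • Z)
    (hxy : ⁅x, y⁆ = 0) {i : ℕ} (hi : 1 ≤ i) (hiN : i ≤ N) :
    ⁅(∑ j ∈ Finset.Ico i N, u j) + x, (∑ j ∈ Finset.Ico i N, v j) + y⁆ = 0 := by
  induction hiN using Nat.decreasingInduction with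
  | self => simp [hxy]
  | of_succ i hiN ih =>
    rw [Finset.sum_eq_sum_Ico_succ_bot hiN, Finset.sum_eq_sum_Ico_succ_bot hiN, add_assoc,
      add_assoc, add_lie, lie_add _ (v i), lie_add _ (v i), ih (by omega), hself i hi hiN,
      lie_tail_of_lt hlt huy hi (Nat.lt_succ_self i) hiN,
      tail_lie_of_lt hgt hxv hi (Nat.lt_succ_self i) hiN, if_pos rfl, if_pos rfl]
    module

lemma tail_lie_tail_of_lt
    (hlt : ∀ i j, 1 ≤ i → i < j → j < N → ⁅u i, v j⁆ = (if j = i + 1 then β else 0) • Z)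
    (hgt : ∀ i j, 1 ≤ j → j < i → i < N → ⁅u i, v j⁆ = (if i = j + 1 then α else 0) • Z)
    (hself : ∀ i, 1 ≤ i → i < N → ⁅u i, v i⁆ = -(α + β) • Z)
    (huy : ∀ i, 1 ≤ i → i < N → ⁅u i, y⁆ = (if i + 1 = N then β else 0) • Z)
    (hxv : ∀ j, 1 ≤ j → j < N → ⁅x, v j⁆ = (if j + 1 = N then α else 0) • Z)
    (hxy : ⁅x, y⁆ = 0) {i j : ℕ} (hj : 1 ≤ j) (hji : j < i) (hiN : i ≤ N) :
    ⁅(∑ k ∈ Finset.Ico i N, u k) + x, (∑ k ∈ Finset.Ico j N, v k) + y⁆ = α • Z := by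
  obtain ⟨i, rfl⟩ : ∃ i', i = i' + 1 := ⟨i - 1, by omega⟩
  have hji' : j ≤ i := by omega
  induction hji' using Nat.decreasingInduction with
  | self =>
    rw [Finset.sum_eq_sum_Ico_succ_bot (show i < N by omega) v, add_assoc, lie_add,
      tail_lie_tail_self hlt hgt hself huy hxv hxy (by omega) hiN,
      tail_lie_of_lt hgt hxv hj (Nat.lt_succ_self i) hiN, if_pos rfl, add_zero]
  | of_succ k hk ih =>
    rw [Finset.sum_eq_sum_Ico_succ_bot (show k < N by omega) v, add_assoc, lie_add,
      ih (by omega) (by omega), tail_lie_of_lt hgt hxv hj hji hiN, if_neg (by omega), zero_smul,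
      zero_add]

end Tail

section Pairing

variable {L : Type*} [LieRing L] [LieAlgebra ℂ L] {Z : L} {E F : ℕ → L}

lemma smul_sub_lie_smul_sub (h : ∀ i j, ⁅E i, F j⁆ = if i = j then Z else 0) (A B T : ℂ)
    (i j : ℕ) :
    ⁅A • (T • E i - T⁻¹ • E (i + 1)), B • (T • F j - T⁻¹ • F (j + 1))⁆ =
      (A * B * ((if i = j then T ^ 2 + (T ^ 2)⁻¹ else 0) - (if i = j + 1 then T * T⁻¹ else 0)
        - (if j = i + 1 then T * T⁻¹ else 0))) • Z := by
  simp only [lie_smul, smul_lie, lie_sub, sub_lie, h, Nat.add_right_cancel_iff,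
    eq_comm (a := i + 1) (b := j)]
  split_ifs <;> first | omega | module

lemma lie_sum_range_smul (h : ∀ i j, ⁅E i, F j⁆ = if i = j then Z else 0) {N i : ℕ} (hi : i < N)
    (r : ℂ) : ⁅E (i + 1), ∑ k ∈ Finset.range N, r ^ k • F (k + 1)⁆ = r ^ i • Z := by
  simp [lie_sum, h, hi]

lemma smul_sub_lie_geom (h : ∀ i j, ⁅E i, F j⁆ = if i = j then Z else 0) {N : ℕ}
    (A B c T : ℂ) (hT : T ≠ 0) {i : ℕ} (hi : 1 ≤ i) (hiN : i < N) :
    ⁅A • (T • E i - T⁻¹ • E (i + 1)),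
      (B * T) • (c • (∑ k ∈ Finset.range N, (T ^ 2) ^ k • F (k + 1)) + F N)⁆ =
      (if i + 1 = N then -(A * B) else 0) • Z := by
  obtain ⟨i, rfl⟩ : ∃ i', i = i' + 1 := ⟨i - 1, by omega⟩
  simp only [lie_smul, smul_lie, lie_add, sub_lie, h, lie_sum_range_smul h (Nat.lt_of_succ_lt hiN),
    lie_sum_range_smul h hiN, if_neg hiN.ne]
  split_ifs
  all_goals
    match_scalars
    field_simp
    ring

lemma geom_lie_geom (h : ∀ i j, ⁅E i, F j⁆ = if i = j then Z else 0) {N : ℕ} (hN : 1 ≤ N)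
    (A B c r : ℂ) (hc : c ^ 2 * ∑ k ∈ Finset.range N, r ^ (2 * k) = 1) :
    ⁅A • (c • (∑ k ∈ Finset.range N, r ^ k • E (k + 1)) + E N),
      B • (-c • (∑ k ∈ Finset.range N, r ^ k • F (k + 1)) + F N)⁆ = 0 := by
  obtain ⟨N, rfl⟩ : ∃ N', N = N' + 1 := ⟨N - 1, by omega⟩
  have hsum : ⁅∑ k ∈ Finset.range (N + 1), r ^ k • E (k + 1),
      ∑ k ∈ Finset.range (N + 1), r ^ k • F (k + 1)⁆ =
      (∑ k ∈ Finset.range (N + 1), r ^ (2 * k)) • Z := by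
    rw [sum_lie, Finset.sum_smul]
    refine Finset.sum_congr rfl fun k hk => ?_
    rw [smul_lie, lie_sum_range_smul h (Finset.mem_range.1 hk), smul_smul, two_mul, pow_add]
  have hl : ⁅∑ k ∈ Finset.range (N + 1), r ^ k • E (k + 1), F (N + 1)⁆ = r ^ N • Z := by
    simp [sum_lie, h]
  have hz : (1 - c ^ 2 * ∑ k ∈ Finset.range (N + 1), r ^ (2 * k)) • Z = 0 := by simp [hc]
  simp only [lie_smul, smul_lie, lie_add, add_lie, hsum, hl, h,
    lie_sum_range_smul h (Nat.lt_succ_self N), if_true]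
  refine Eq.trans ?_ ((congrArg ((A * B) • ·) hz).trans (smul_zero _))
  module

end Pairing

/-- With `a_{im} = h̄_{im} + h̄_{i+1,m} + ⋯ + h̄_{N-1,m} + a_{Nm}` (so `a_{im} = h̄_{im} + a_{i+1,m}`),
one has `[a_{im}, a_{in}] = 0` for each `i`, and `[a_{im}, a_{jn}] = -(q^m/m)[m][mc] δ_{m,-n}`
for `i > j`. -/
theorem stmt17 (N : ℕ) (hN : 2 ≤ N) (L : Type*) [LieRing L] [LieAlgebra ℂ L]
    (q t qc : ℂ) (hq0 : q ≠ 0) (ht : t ≠ 0) (hqt : q = t ^ 2)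
    (hroot : ∀ k : ℕ, 0 < k → q ^ k ≠ 1)
    (K : L) (hK : ∀ x : L, ⁅K, x⁆ = 0)
    (e : ℕ → ℤ → L)
    (hrel : ∀ (i j : ℕ) (m n : ℤ),
      ⁅e i m, e j n⁆ = (if i = j ∧ n = -m then
          (q ^ m - q ^ (-m)) / (q - q⁻¹) / (m : ℂ)
            * ((qc ^ m - qc ^ (-m)) / (q - q⁻¹)) else 0) • K)
    (s : ℕ → ℂ) (hs0 : ∀ k, s k ≠ 0)
    (hs : ∀ k : ℕ, s k ^ 2 = ∑ j ∈ Finset.range N, q ^ (2 * j * k))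
    (aN : ℤ → L)
    (haN : ∀ m : ℤ, aN m = (q ^ ((N : ℤ) * m) * t ^ (m.natAbs : ℤ)) •
        (((m.sign : ℂ) / s m.natAbs) •
            (∑ k ∈ Finset.range N, q ^ ((k : ℤ) * (m.natAbs : ℤ)) • e (k + 1) m)
          + e N m))
    (oh : ℕ → ℤ → L)
    (hoh : ∀ (i : ℕ) (m : ℤ), oh i m = q ^ ((i : ℤ) * m) •
        (t ^ (m.natAbs : ℤ) • e i m - t ^ (-(m.natAbs : ℤ)) • e (i + 1) m))
    (a : ℕ → ℤ → L)
    (ha : ∀ (i : ℕ) (m : ℤ), a i m = (∑ j ∈ Finset.Ico i N, oh j m) + aN m) :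
    (∀ i : ℕ, 1 ≤ i → i ≤ N → ∀ m n : ℤ, m ≠ 0 → n ≠ 0 → ⁅a i m, a i n⁆ = 0)
    ∧ (∀ i j : ℕ, 1 ≤ j → j < i → i ≤ N → ∀ m n : ℤ, m ≠ 0 → n ≠ 0 →
      ⁅a i m, a j n⁆ = (if n = -m then
          -(q ^ m / (m : ℂ)) * ((q ^ m - q ^ (-m)) / (q - q⁻¹))
            * ((qc ^ m - qc ^ (-m)) / (q - q⁻¹)) else 0) • K) := by
  have hT : ∀ m : ℤ, t ^ (m.natAbs : ℤ) ≠ 0 := fun m => zpow_ne_zero _ ht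
  have hqT : ∀ m : ℤ, q ^ (m.natAbs : ℤ) = (t ^ (m.natAbs : ℤ)) ^ 2 := fun m => by
    rw [hqt, zpow_natCast, zpow_natCast, ← pow_mul, ← pow_mul, mul_comm]
  have hkT : ∀ (k : ℕ) (m : ℤ),
      q ^ ((k : ℤ) * (m.natAbs : ℤ)) = ((t ^ (m.natAbs : ℤ)) ^ 2) ^ k := fun k m => by
    rw [← hqT, mul_comm, zpow_mul, zpow_natCast _ k]
  have hQT : ∀ m : ℤ, (t ^ (m.natAbs : ℤ)) ^ 2 + ((t ^ (m.natAbs : ℤ)) ^ 2)⁻¹ =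
      q ^ m + (q ^ m)⁻¹ := fun m => by
    rw [← hqT]
    obtain h | h := Int.natAbs_eq m
    · rw [← h]
    · conv_rhs => rw [h]
      rw [zpow_neg, inv_inv, add_comm]
  have hoh' : ∀ (i : ℕ) (m : ℤ), oh i m = q ^ ((i : ℤ) * m) •
      (t ^ (m.natAbs : ℤ) • e i m - (t ^ (m.natAbs : ℤ))⁻¹ • e (i + 1) m) := fun i m => by
    rw [hoh, zpow_neg]
  have haN' : ∀ m : ℤ, aN m = (q ^ ((N : ℤ) * m) * t ^ (m.natAbs : ℤ)) •
      (((m.sign : ℂ) / s m.natAbs) •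
        (∑ k ∈ Finset.range N, ((t ^ (m.natAbs : ℤ)) ^ 2) ^ k • e (k + 1) m) + e N m) :=
    fun m => by
      rw [haN]
      simp only [hkT]
  have hq1 : ∀ (i j : ℕ) (m : ℤ),
      q ^ ((i : ℤ) * m) * q ^ ((j : ℤ) * -m) = q ^ (((i : ℤ) - j) * m) := fun i j m => by
    rw [← zpow_add₀ hq0]
    congr 1
    ring
  have hcomm : ∀ m n : ℤ, n ≠ -m → ∀ i j, ⁅a i m, a j n⁆ = 0 := fun m n hmn i j => by
    have he : ∀ i j, ⁅e i m, e j n⁆ = 0 := fun i j => by simp [hrel, hmn]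
    simp only [ha, hoh', haN', lie_add, add_lie, lie_sum, sum_lie, lie_smul, smul_lie, lie_sub,
      sub_lie, he, smul_zero, Finset.sum_const_zero, add_zero, sub_zero]
  have key : ∀ m : ℤ, m ≠ 0 → ∃ Z : L,
      Z = ((q ^ m - q ^ (-m)) / (q - q⁻¹) / (m : ℂ) * ((qc ^ m - qc ^ (-m)) / (q - q⁻¹))) • K ∧
      (∀ i, 1 ≤ i → i ≤ N → ⁅a i m, a i (-m)⁆ = 0) ∧
      (∀ i j, 1 ≤ j → j < i → i ≤ N → ⁅a i m, a j (-m)⁆ = (-q ^ m) • Z) := by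
    intro m hm
    refine ⟨_, rfl, ?_⟩
    set Z : L :=
      ((q ^ m - q ^ (-m)) / (q - q⁻¹) / (m : ℂ) * ((qc ^ m - qc ^ (-m)) / (q - q⁻¹))) • K with hZ
    have hEF : ∀ i j, ⁅e i m, e j (-m)⁆ = if i = j then Z else 0 := fun i j => by
      rw [hrel]
      by_cases hij : i = j <;> simp [hij, hZ]
    have hFE : ∀ i j, ⁅e i (-m), e j m⁆ = if i = j then -Z else 0 := fun i j => by
      rw [← lie_skew, hEF]
      by_cases hij : i = j <;> simp [hij, eq_comm]
    have hTT := mul_inv_cancel₀ (hT m)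
    have hoo := fun i j : ℕ => smul_sub_lie_smul_sub hEF (q ^ ((i : ℤ) * m))
      (q ^ ((j : ℤ) * -m)) (t ^ (m.natAbs : ℤ)) i j
    simp only [hq1, hTT, hQT] at hoo
    have hlt : ∀ i j, 1 ≤ i → i < j → j < N →
        ⁅oh i m, oh j (-m)⁆ = (if j = i + 1 then -(q ^ m)⁻¹ else 0) • Z := by
      intro i j _ hij _
      rw [hoh', hoh', Int.natAbs_neg, hoo, if_neg (by omega), if_neg (by omega)]
      split_ifs with h
      · subst h
        rw [← zpow_neg]
        push_cast
        ring_nf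
      · simp
    have hgt : ∀ i j, 1 ≤ j → j < i → i < N →
        ⁅oh i m, oh j (-m)⁆ = (if i = j + 1 then -q ^ m else 0) • Z := by
      intro i j _ hij _
      rw [hoh', hoh', Int.natAbs_neg, hoo, if_neg (by omega), if_neg (show ¬ j = i + 1 by omega)]
      split_ifs with h
      · subst h
        push_cast
        ring_nf
      · simp
    have hself : ∀ i, 1 ≤ i → i < N →
        ⁅oh i m, oh i (-m)⁆ = -(-q ^ m + -(q ^ m)⁻¹) • Z := by
      intro i _ _
      rw [hoh', hoh', Int.natAbs_neg, hoo]
      simp [add_comm]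
    have hoa : ∀ i, 1 ≤ i → i < N →
        ⁅oh i m, aN (-m)⁆ = (if i + 1 = N then -(q ^ m)⁻¹ else 0) • Z := by
      intro i hi hiN
      rw [hoh', haN', Int.natAbs_neg, smul_sub_lie_geom hEF _ _ _ _ (hT m) hi hiN, hq1]
      split_ifs with h
      · rw [← h, ← zpow_neg]
        push_cast
        ring_nf
      · rfl
    have hao : ∀ j, 1 ≤ j → j < N →
        ⁅aN m, oh j (-m)⁆ = (if j + 1 = N then -q ^ m else 0) • Z := by
      intro j hj hjN
      rw [← lie_skew, hoh', haN', Int.natAbs_neg, smul_sub_lie_geom hFE _ _ _ _ (hT m) hj hjN,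
        mul_comm (q ^ _), hq1]
      split_ifs with h
      · rw [← h]
        push_cast
        ring_nf
        simp
      · simp
    have haa : ⁅aN m, aN (-m)⁆ = 0 := by
      rw [haN', haN', Int.natAbs_neg, Int.sign_neg, Int.cast_neg, neg_div]
      refine geom_lie_geom hEF (by omega) _ _ _ _ ?_
      have hsum : ∑ k ∈ Finset.range N, ((t ^ (m.natAbs : ℤ)) ^ 2) ^ (2 * k) =
          s m.natAbs ^ 2 := by
        rw [hs]
        refine Finset.sum_congr rfl fun k _ => ?_
        rw [← hqT, zpow_natCast, ← pow_mul, mul_comm]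
      have hsign : (m.sign : ℂ) ^ 2 = 1 := by
        rcases hm.lt_or_gt with h | h
        · simp [Int.sign_eq_neg_one_of_neg h]
        · simp [Int.sign_eq_one_of_pos h]
      rw [hsum, div_pow, hsign, one_div, inv_mul_cancel₀ (pow_ne_zero 2 (hs0 _))]
    constructor
    · intro i hi hiN
      rw [ha, ha]
      exact tail_lie_tail_self hlt hgt hself hoa hao haa hi hiN
    · intro i j hj hji hiN
      rw [ha, ha]
      exact tail_lie_tail_of_lt hlt hgt hself hoa hao haa hj hji hiN
  constructor
  · intro i hi hiN m n hm _
    by_cases h : n = -m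
    · subst h
      obtain ⟨_, _, h1, _⟩ := key m hm
      exact h1 i hi hiN
    · exact hcomm m n h i i
  · intro i j hj hji hiN m n hm _
    by_cases h : n = -m
    · subst h
      obtain ⟨Z, rfl, _, h2⟩ := key m hm
      rw [h2 i j hj hji hiN, if_pos rfl, smul_smul]
      congr 1
      ring
    · rw [hcomm m n h, if_neg h, zero_smul]
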